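/- For every ρ ∈ (0,1) there exist constants C = C(ρ) > 4 and C' = C'(ρ) such that: for all x, y ∈ ℝ², every Radon measure μ on ℝ², and every interval I ⊂ 𝕋, ∫_{C·d_I(x,y)}^{1/2} μ(X(y,1.5I,ρr,r))·r⁻² dr ≤ C'·∫_{C·d_I(x,y)/2}^{1} μ(X(x,2I,ρr,r))·r⁻² dr. -/

import Mathlib

open MeasureTheory Metric Set
open scoped ENNReal NNReal

noncomputable section

abbrev R2 := EuclideanSpace ℝ (Fin 2)

/-- The unit vector in direction `2πθ`. -/
def dir (θ : ℝ) : R2 :=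
  (EuclideanSpace.equiv (Fin 2) ℝ).symm ![Real.cos (2 * Real.pi * θ), Real.sin (2 * Real.pi * θ)]

/-- Orthogonal projection `π_θ`. -/
def proj (θ : ℝ) (x : R2) : ℝ :=
  x 0 * Real.cos (2 * Real.pi * θ) + x 1 * Real.sin (2 * Real.pi * θ)

/-- `π_θ^⊥ = π_{θ+1/4}`. -/
def projPerp (θ : ℝ) (x : R2) : ℝ := proj (θ + 1/4) x

/-- Favard length. -/
def Fav (E : Set R2) : ℝ≥0∞ := ∫⁻ θ in Set.Icc (0:ℝ) 1, μH[1] (proj θ '' E)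

/-- Ahlfors regularity with constant `A`. -/
def AhlforsRegular (A : ℝ) (E : Set R2) : Prop :=
  IsClosed E ∧ ∀ x ∈ E, ∀ r : ℝ, 0 < r → ENNReal.ofReal r < EMetric.diam E →
    ENNReal.ofReal (A⁻¹ * r) ≤ μH[1] (E ∩ ball x r) ∧
      μH[1] (E ∩ ball x r) ≤ ENNReal.ofReal (A * r)

/-- A Lipschitz graph with constant `L`: rotated graph of an `L`-Lipschitz function. -/
def IsLipschitzGraph (L : ℝ) (Γ : Set R2) : Prop :=
  ∃ (R : R2 ≃ₗᵢ[ℝ] R2) (f : ℝ → ℝ), LipschitzWith (Real.toNNReal L) f ∧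
    Γ = R '' {x : R2 | x 1 = f (x 0)}

/-- The (untruncated) cone `X(x,G)`. -/
def cone (x : R2) (G : Set ℝ) : Set R2 := ⋃ θ ∈ G, {y | ∃ t : ℝ, y = x + t • dir θ}

/-- The truncated cone `X(x,G,r)`. -/
def coneT (x : R2) (G : Set ℝ) (r : ℝ) : Set R2 := cone x G ∩ ball x r

/-- The doubly truncated cone `X(x,G,r,R)`. -/
def coneA (x : R2) (G : Set ℝ) (r R : ℝ) : Set R2 := coneT x G R \ ball x r

/-- Hardy–Littlewood maximal function of a measure on `ℝ`. -/
def maximalFn (ν : Measure ℝ) (t : ℝ) : ℝ≥0∞ :=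
  ⨆ (r : ℝ) (_ : 0 < r), ν (Set.Ioo (t - r) (t + r)) / ENNReal.ofReal (2 * r)

/-- `μ_θ(x) = M(π_θ μ)(π_θ x)`. -/
def projMax (μ : Measure R2) (θ : ℝ) (x : R2) : ℝ≥0∞ :=
  maximalFn (μ.map (proj θ)) (proj θ x)

/-- `μ_θ^⊥(x) = M(π_θ^⊥ μ)(π_θ^⊥ x)`. -/
def projMaxPerp (μ : Measure R2) (θ : ℝ) (x : R2) : ℝ≥0∞ :=
  maximalFn (μ.map (projPerp θ)) (projPerp θ x)

/-- The interval with center `c` and length `ℓ`. -/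
def itv (c ℓ : ℝ) : Set ℝ := Set.Icc (c - ℓ/2) (c + ℓ/2)

/-- The metric `d_I` associated to the interval with center `c` and length `ℓ`. -/
def dmet (c ℓ : ℝ) (x y : R2) : ℝ :=
  Real.sqrt ((ℓ^2)⁻¹ * (projPerp c x - projPerp c y)^2 + (proj c x - proj c y)^2)

/-- The open `d_I`-ball `B_I(x,r)`. -/
def bmet (c ℓ : ℝ) (x : R2) (r : ℝ) : Set R2 := {y | dmet c ℓ x y < r}

/-- Triadic intervals of `[0,1)`. -/
def IsTriadic (I : Set ℝ) : Prop :=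
  ∃ (j k : ℕ), k < 3^j ∧ I = Set.Ico ((k : ℝ)/3^j) ((k+1 : ℝ)/3^j)

/-- 1-dimensional Hausdorff content. -/
def hContent {X : Type*} [EMetricSpace X] (s : Set X) : ℝ≥0∞ :=
  ⨅ (t : ℕ → Set X) (_ : s ⊆ ⋃ n, t n), ∑' n, EMetric.diam (t n)

/-- `E` is a finite union of parallel segments. -/
def FinUnionParallelSegments (E : Set R2) : Prop :=
  ∃ (n : ℕ) (d : R2) (p q : Fin n → R2), d ≠ 0 ∧
    (∀ i, ∃ t : ℝ, q i - p i = t • d) ∧ E = ⋃ i, segment ℝ (p i) (q i)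


lemma proj_sub (θ : ℝ) (x y : R2) : proj θ (x - y) = proj θ x - proj θ y := by
  simp only [proj, PiLp.sub_apply]; ring

lemma projPerp_sub (θ : ℝ) (x y : R2) : projPerp θ (x - y) = projPerp θ x - projPerp θ y :=
  proj_sub _ x y

lemma projPerp_eq (θ : ℝ) (x : R2) :
    projPerp θ x = -x 0 * Real.sin (2 * Real.pi * θ) + x 1 * Real.cos (2 * Real.pi * θ) := by
  have h : 2 * Real.pi * (θ + 1 / 4) = 2 * Real.pi * θ + Real.pi / 2 := by ring
  simp only [projPerp, proj, h, Real.cos_add_pi_div_two, Real.sin_add_pi_div_two]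
  ring

lemma dir_zero (θ : ℝ) : dir θ 0 = Real.cos (2 * Real.pi * θ) := by simp [dir]

lemma dir_one (θ : ℝ) : dir θ 1 = Real.sin (2 * Real.pi * θ) := by simp [dir]

lemma proj_smul_dir (c θ t : ℝ) :
    proj c (t • dir θ) = t * Real.cos (2 * Real.pi * (θ - c)) := by
  have h : 2 * Real.pi * (θ - c) = 2 * Real.pi * θ - 2 * Real.pi * c := by ring
  simp only [proj, PiLp.smul_apply, dir_zero, dir_one, smul_eq_mul, h, Real.cos_sub]
  ring

lemma projPerp_smul_dir (c θ t : ℝ) :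
    projPerp c (t • dir θ) = t * Real.sin (2 * Real.pi * (θ - c)) := by
  have h : 2 * Real.pi * (θ - c) = 2 * Real.pi * θ - 2 * Real.pi * c := by ring
  simp only [projPerp_eq, PiLp.smul_apply, dir_zero, dir_one, smul_eq_mul, h, Real.sin_sub]
  ring

lemma norm_sq_eq_proj (c : ℝ) (w : R2) : ‖w‖ ^ 2 = proj c w ^ 2 + projPerp c w ^ 2 := by
  rw [EuclideanSpace.real_norm_sq_eq, Fin.sum_univ_two, projPerp_eq, proj]
  linear_combination (-(w 0 ^ 2 + w 1 ^ 2)) * Real.sin_sq_add_cos_sq (2 * Real.pi * c)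

lemma eq_of_proj_eq {c : ℝ} {v w : R2} (h : proj c v = proj c w)
    (h' : projPerp c v = projPerp c w) : v = w := by
  have := norm_sq_eq_proj c (v - w)
  rw [proj_sub, projPerp_sub, h, h'] at this
  simpa [sub_eq_zero] using this

lemma norm_dir (θ : ℝ) : ‖dir θ‖ = 1 := by
  have h := norm_sq_eq_proj θ (dir θ)
  have h1 := proj_smul_dir θ θ 1
  have h2 := projPerp_smul_dir θ θ 1
  simp only [one_smul, sub_self, mul_zero, Real.cos_zero, Real.sin_zero, mul_one] at h1 h2
  rw [h1, h2] at h
  nlinarith [norm_nonneg (dir θ)]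

lemma dmet_nonneg (c ℓ : ℝ) (x y : R2) : 0 ≤ dmet c ℓ x y := Real.sqrt_nonneg _

lemma dmet_sq (c ℓ : ℝ) (x y : R2) :
    dmet c ℓ x y ^ 2 = (ℓ ^ 2)⁻¹ * projPerp c (x - y) ^ 2 + proj c (x - y) ^ 2 := by
  rw [dmet, Real.sq_sqrt (by positivity), proj_sub, projPerp_sub]

lemma abs_proj_sub_le_dmet (c ℓ : ℝ) (x y : R2) : |proj c (x - y)| ≤ dmet c ℓ x y := by
  refine abs_le_of_sq_le_sq ?_ (dmet_nonneg ..)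
  rw [dmet_sq]
  exact le_add_of_nonneg_left (by positivity)

lemma abs_projPerp_sub_le_dmet {c ℓ : ℝ} (hℓ : 0 < ℓ) (x y : R2) :
    |projPerp c (x - y)| ≤ ℓ * dmet c ℓ x y := by
  refine abs_le_of_sq_le_sq ?_ (mul_nonneg hℓ.le (dmet_nonneg ..))
  rw [mul_pow, dmet_sq, mul_add, mul_inv_cancel_left₀ (by positivity)]
  exact le_add_of_nonneg_right (by positivity)

lemma dist_le_two_mul_dmet {c ℓ : ℝ} (hℓ : 0 < ℓ) (hℓ1 : ℓ ≤ 1) (x y : R2) :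
    dist x y ≤ 2 * dmet c ℓ x y := by
  have hd := dmet_nonneg c ℓ x y
  have h1 := sq_le_sq' (neg_le_of_abs_le (abs_proj_sub_le_dmet c ℓ x y))
    (le_of_abs_le (abs_proj_sub_le_dmet c ℓ x y))
  have hp : |projPerp c (x - y)| ≤ dmet c ℓ x y :=
    (abs_projPerp_sub_le_dmet hℓ x y).trans (mul_le_of_le_one_left hd hℓ1)
  have h2 := sq_le_sq' (neg_le_of_abs_le hp) (le_of_abs_le hp)
  rw [dist_eq_norm]
  refine (sq_le_sq₀ (norm_nonneg _) (by positivity)).1 ?_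
  rw [norm_sq_eq_proj c]
  nlinarith

/-- A point lies in the cone around direction `c` as soon as its slope in the frame of `c` is
controlled, with no condition once the aperture covers all directions. -/
lemma mem_cone_itv {c ℓ : ℝ} (hℓ : 0 < ℓ) {x z : R2}
    (h : ℓ < 1 / 4 → |projPerp c (z - x)| * Real.cos (2 * Real.pi * ℓ) ≤
      |proj c (z - x)| * Real.sin (2 * Real.pi * ℓ)) :
    z ∈ cone x (itv c (2 * ℓ)) := by
  have hpi := Real.pi_pos
  simp only [cone, mem_iUnion, mem_ofPred_eq, itv, exists_prop]
  suffices H : ∃ φ t : ℝ, |φ| ≤ 2 * Real.pi * ℓ ∧ proj c (z - x) = t * Real.cos φ ∧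
      projPerp c (z - x) = t * Real.sin φ by
    obtain ⟨φ, t, hφ, hP, hQ⟩ := H
    have hφ' : |φ / (2 * Real.pi)| ≤ ℓ := by
      rw [abs_div, abs_of_pos (by positivity : 0 < 2 * Real.pi), div_le_iff₀ (by positivity)]
      linarith
    have e : 2 * Real.pi * (c + φ / (2 * Real.pi) - c) = φ := by field_simp; ring
    refine ⟨c + φ / (2 * Real.pi), ?_, t, ?_⟩
    · rw [abs_le] at hφ'
      constructor <;> linarith
    · rw [← sub_eq_iff_eq_add']
      refine eq_of_proj_eq (c := c) ?_ ?_
      · rw [proj_smul_dir, e, hP]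
      · rw [projPerp_smul_dir, e, hQ]
  generalize proj c (z - x) = P at h ⊢
  generalize projPerp c (z - x) = Q at h ⊢
  by_cases hP : P = 0
  · rcases lt_or_ge ℓ (1 / 4) with hl | hl
    · have hcos : 0 < Real.cos (2 * Real.pi * ℓ) :=
        Real.cos_pos_of_mem_Ioo ⟨by nlinarith, by nlinarith⟩
      have hQ : Q = 0 := by
        have h0 := h hl
        rw [hP, abs_zero, zero_mul] at h0
        exact abs_nonpos_iff.1 (nonpos_of_mul_nonpos_left h0 hcos)
      exact ⟨0, 0, by simpa using by positivity, by simp [hP], by simp [hQ]⟩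
    · refine ⟨Real.pi / 2, Q, ?_, by simp [hP], by simp⟩
      rw [abs_of_pos (by positivity)]
      nlinarith
  · have hcos := Real.cos_arctan_pos (Q / P)
    refine ⟨Real.arctan (Q / P), P / Real.cos (Real.arctan (Q / P)), ?_, ?_, ?_⟩
    · rcases lt_or_ge ℓ (1 / 4) with hl | hl
      · have hc : 0 < Real.cos (2 * Real.pi * ℓ) :=
          Real.cos_pos_of_mem_Ioo ⟨by nlinarith, by nlinarith⟩
        have hslope : |Q / P| ≤ Real.tan (2 * Real.pi * ℓ) := by
          rw [abs_div, Real.tan_eq_sin_div_cos, div_le_div_iff₀ (abs_pos.2 hP) hc]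
          linarith [h hl]
        have harc : Real.arctan (Real.tan (2 * Real.pi * ℓ)) = 2 * Real.pi * ℓ :=
          Real.arctan_tan (by nlinarith) (by nlinarith)
        rw [abs_le] at hslope ⊢
        constructor
        · have := Real.arctan_strictMono.monotone hslope.1
          rw [Real.arctan_neg, harc] at this
          exact this
        · have := Real.arctan_strictMono.monotone hslope.2
          rwa [harc] at this
      · have h1 := Real.arctan_lt_pi_div_two (Q / P)
        have h2 := Real.neg_pi_div_two_lt_arctan (Q / P)
        rw [abs_le]
        constructor <;> nlinarith
    · field_simp
    · have ht : Real.sin (Real.arctan (Q / P)) = Q / P * Real.cos (Real.arctan (Q / P)) := by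
        conv_rhs => rw [← Real.tan_arctan (Q / P)]
        rw [Real.arctan_tan (Real.neg_pi_div_two_lt_arctan _) (Real.arctan_lt_pi_div_two _),
          Real.tan_mul_cos hcos.ne']
      rw [ht]
      field_simp

/-- Away from the vertex, a cone is contained in a wider cone with a `d_I`-nearby vertex. -/
lemma mem_cone_of_mem_cone {c ℓ : ℝ} (hℓ : 0 < ℓ) {x y z : R2}
    (hz : z ∈ cone y (itv c (1.5 * ℓ))) (hd : 8 * dmet c ℓ x y ≤ dist z y) :
    z ∈ cone x (itv c (2 * ℓ)) := by
  have hpi := Real.pi_pos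
  refine mem_cone_itv hℓ fun hl => ?_
  simp only [cone, mem_iUnion, mem_ofPred_eq, itv, exists_prop] at hz
  obtain ⟨θ, ⟨h1, h2⟩, s, rfl⟩ := hz
  have hs : dist (y + s • dir θ) y = |s| := by
    rw [dist_eq_norm, add_sub_cancel_left, norm_smul, norm_dir, mul_one, Real.norm_eq_abs]
  rw [hs] at hd
  have hx : y + s • dir θ - x = s • dir θ - (x - y) := by abel
  rw [hx, proj_sub, projPerp_sub, proj_smul_dir, projPerp_smul_dir]
  have hp := abs_proj_sub_le_dmet c ℓ x y
  have hq := abs_projPerp_sub_le_dmet (c := c) hℓ x y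
  have hd0 := dmet_nonneg c ℓ x y
  generalize proj c (x - y) = p at hp ⊢
  generalize projPerp c (x - y) = q at hq ⊢
  generalize dmet c ℓ x y = d at hp hq hd hd0
  set φ := 2 * Real.pi * (θ - c) with hφ
  have hφle : |φ| ≤ 2 * Real.pi * (3 / 4 * ℓ) := by
    rw [hφ, abs_mul, abs_of_pos (by positivity : 0 < 2 * Real.pi)]
    refine mul_le_mul_of_nonneg_left ?_ (by positivity)
    rw [abs_le]
    constructor <;> linarith
  have hα : 2 * Real.pi * ℓ < Real.pi / 2 := by nlinarith
  have hφ0 := abs_nonneg φ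
  have hcosα : 0 ≤ Real.cos (2 * Real.pi * ℓ) :=
    (Real.cos_pos_of_mem_Ioo ⟨by nlinarith, hα⟩).le
  have hsinα : 0 ≤ Real.sin (2 * Real.pi * ℓ) :=
    Real.sin_nonneg_of_nonneg_of_le_pi (by positivity) (by linarith)
  have hsinα' : Real.sin (2 * Real.pi * ℓ) ≤ 7 * ℓ :=
    (Real.sin_le (by positivity)).trans (by nlinarith [Real.pi_lt_d2])
  have hcosφ : 0 ≤ Real.cos φ := by
    rw [← Real.cos_abs]
    exact Real.cos_nonneg_of_mem_Icc ⟨by linarith, by nlinarith⟩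
  have hsinφ : |Real.sin φ| = Real.sin |φ| := Real.abs_sin_eq_sin_abs_of_abs_le_pi (by nlinarith)
  have hgap : ℓ ≤ Real.sin (2 * Real.pi * ℓ - |φ|) := by
    have hJ := Real.mul_le_sin (x := Real.pi / 2 * ℓ) (by positivity) (by nlinarith)
    have hm : Real.sin (Real.pi / 2 * ℓ) ≤ Real.sin (2 * Real.pi * ℓ - |φ|) :=
      Real.sin_le_sin_of_le_of_le_pi_div_two (by nlinarith) (by linarith) (by nlinarith)
    have e : 2 / Real.pi * (Real.pi / 2 * ℓ) = ℓ := by field_simp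
    linarith
  rw [Real.sin_sub, Real.cos_abs, ← hsinφ] at hgap
  have hQ : |s * Real.sin φ - q| ≤ |s| * |Real.sin φ| + ℓ * d := by
    rw [← abs_mul]
    exact (abs_sub _ _).trans (by linarith)
  have hP : |s| * Real.cos φ - d ≤ |s * Real.cos φ - p| := by
    have := abs_sub_abs_le_abs_sub (s * Real.cos φ) p
    rw [abs_mul, abs_of_nonneg hcosφ] at this
    linarith
  have hcos1 := Real.cos_le_one (2 * Real.pi * ℓ)
  calc |s * Real.sin φ - q| * Real.cos (2 * Real.pi * ℓ)
      ≤ (|s| * |Real.sin φ| + ℓ * d) * Real.cos (2 * Real.pi * ℓ) := by gcongr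
    _ ≤ (|s| * Real.cos φ - d) * Real.sin (2 * Real.pi * ℓ) := by
      have e1 := mul_le_mul_of_nonneg_left hgap (abs_nonneg s)
      have e2 : ℓ * d * Real.cos (2 * Real.pi * ℓ) ≤ ℓ * d :=
        mul_le_of_le_one_right (by positivity) hcos1
      have e3 := mul_le_mul_of_nonneg_left hsinα' hd0
      have e4 := mul_le_mul_of_nonneg_right hd hℓ.le
      nlinarith
    _ ≤ |s * Real.cos φ - p| * Real.sin (2 * Real.pi * ℓ) := by gcongr

/-- A truncated cone is covered by two truncated cones of comparable scales with a nearby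
vertex. -/
lemma coneA_subset_union {ρ : ℝ} (hρ0 : 0 < ρ) (hρ1 : ρ < 1) {c ℓ : ℝ} (hℓ : 0 < ℓ)
    (hℓ1 : ℓ ≤ 1) {x y : R2} {r : ℝ} (hr : 16 / (ρ * (1 - ρ)) * dmet c ℓ x y < r) :
    coneA y (itv c (1.5 * ℓ)) (ρ * r) r ⊆
      coneA x (itv c (2 * ℓ)) (ρ * ((1 + ρ) / 2 * r)) ((1 + ρ) / 2 * r) ∪
        coneA x (itv c (2 * ℓ)) (ρ * ((3 - ρ) / 2 * r)) ((3 - ρ) / 2 * r) := by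
  have hd0 := dmet_nonneg c ℓ x y
  have hρ' : 0 < 1 - ρ := by linarith
  have hr' : 16 * dmet c ℓ x y < r * (ρ * (1 - ρ)) := by
    rwa [div_mul_eq_mul_div, div_lt_iff₀ (by positivity)] at hr
  have hr0 : 0 < r := lt_of_le_of_lt (by positivity) hr
  have hxy := dist_le_two_mul_dmet (c := c) hℓ hℓ1 x y
  have hm : r * (ρ * (1 - ρ)) ≤ ρ * r := by nlinarith [mul_pos hρ0 hr0]
  have hm' : r * (ρ * (1 - ρ)) ≤ (1 - ρ) * r := by nlinarith [mul_pos hρ' hr0]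
  rintro z ⟨⟨hz, hzr⟩, hzρ⟩
  rw [mem_ball] at hzr hzρ
  rw [not_lt] at hzρ
  have hcone := mem_cone_of_mem_cone hℓ (x := x) hz (by linarith)
  have t1 := dist_triangle z x y
  have t2 := dist_triangle_right z x y
  have hsq : 0 ≤ (1 - ρ) ^ 2 * r := by positivity
  by_cases hzx : dist z x < (1 + ρ) / 2 * r
  · refine Or.inl ⟨⟨hcone, hzx⟩, ?_⟩
    rw [mem_ball, not_lt]
    nlinarith
  · refine Or.inr ⟨⟨hcone, ?_⟩, ?_⟩
    · rw [mem_ball]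
      linarith
    · rw [mem_ball, not_lt]
      nlinarith

lemma measurable_measure_coneA (μ : Measure R2) [IsLocallyFiniteMeasure μ] (x : R2) (G : Set ℝ)
    {ρ : ℝ} (hρ0 : 0 < ρ) (hρ1 : ρ < 1) :
    Measurable fun r => μ (coneA x G (ρ * r) r) := by
  have hmono : Monotone fun r => μ (coneT x G r) := fun a b hab =>
    measure_mono (inter_subset_inter_right _ (ball_subset_ball hab))
  have heq : (fun r => μ (coneA x G (ρ * r) r)) =
      fun r => μ (coneT x G r) - μ (coneT x G (ρ * r)) := by
    funext r
    have hsub : ball x (ρ * r) ⊆ ball x r := by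
      rcases le_or_gt r 0 with h | h
      · rw [ball_eq_empty.2 (mul_nonpos_of_nonneg_of_nonpos hρ0.le h)]
        exact empty_subset _
      · exact ball_subset_ball (mul_le_of_le_one_left h.le hρ1.le)
    have hI : coneT x G r ∩ ball x (ρ * r) = coneT x G (ρ * r) := by
      rw [coneT, coneT, inter_assoc, inter_eq_self_of_subset_right hsub]
    have h := measure_inter_add_sdiff (μ := μ) (coneT x G r) (measurableSet_ball (x := x) (ε := ρ * r))
    rw [hI] at h
    have hfin : μ (coneT x G (ρ * r)) ≠ ∞ :=
      ((measure_mono inter_subset_right).trans_lt measure_ball_lt_top).ne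
    exact ENNReal.eq_sub_of_add_eq hfin ((add_comm _ _).trans h)
  rw [heq]
  exact hmono.measurable.sub (hmono.measurable.comp (measurable_const_mul ρ))

lemma setLIntegral_comp_mul_div_sq {f : ℝ → ℝ≥0∞} (hf : Measurable f) {a u v : ℝ} (ha : 0 < a)
    (hu : 0 ≤ u) :
    ∫⁻ r in Ioc u v, f (a * r) / ENNReal.ofReal (r ^ 2) =
      ENNReal.ofReal a * ∫⁻ r in Ioc (a * u) (a * v), f r / ENNReal.ofReal (r ^ 2) := by
  have hh : Measurable fun r : ℝ => f r / ENNReal.ofReal (r ^ 2) :=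
    hf.div (by fun_prop)
  have hpre : (a * ·) ⁻¹' Ioc (a * u) (a * v) = Ioc u v := by
    ext r
    simp only [mem_preimage, mem_Ioc, mul_lt_mul_iff_right₀ ha, mul_le_mul_iff_right₀ ha]
  conv_rhs => rw [← Real.smul_map_volume_mul_left ha.ne', Measure.restrict_smul,
    lintegral_smul_measure, setLIntegral_map measurableSet_Ioc hh (measurable_const_mul a), hpre,
    abs_of_pos ha, smul_eq_mul]
  rw [← mul_assoc, ← lintegral_const_mul _ (by fun_prop)]
  refine setLIntegral_congr_fun measurableSet_Ioc fun r hr => ?_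
  have hr0 : 0 < r := hu.trans_lt hr.1
  have ha' : ENNReal.ofReal (a ^ 2) ≠ 0 := by simpa using by positivity
  rw [← ENNReal.ofReal_mul ha.le, ← sq, mul_pow, ENNReal.ofReal_mul (by positivity),
    ← mul_div_assoc, ENNReal.mul_div_mul_left _ _ ha' ENNReal.ofReal_ne_top]

/-- conical energy estimates transfer to `d_I`-nearby points. -/
theorem statement13 (ρ : ℝ) (hρ0 : 0 < ρ) (hρ1 : ρ < 1) :
    ∃ C C' : ℝ, 4 < C ∧ 0 < C' ∧
      ∀ (x y : R2) (μ : Measure R2), IsLocallyFiniteMeasure μ →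
        ∀ (c ℓ : ℝ), 0 < ℓ → ℓ ≤ 1 →
          (∫⁻ r in Set.Ioc (C * dmet c ℓ x y) ((1:ℝ)/2),
              μ (coneA y (itv c (1.5 * ℓ)) (ρ*r) r) / ENNReal.ofReal (r^2)) ≤
            ENNReal.ofReal C' *
              ∫⁻ r in Set.Ioc (C * dmet c ℓ x y / 2) (1:ℝ),
                μ (coneA x (itv c (2 * ℓ)) (ρ*r) r) / ENNReal.ofReal (r^2) := by
  have hρ' : 0 < 1 - ρ := by linarith
  have hC : 4 < 16 / (ρ * (1 - ρ)) := by
    rw [lt_div_iff₀ (by positivity)]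
    nlinarith
  refine ⟨16 / (ρ * (1 - ρ)), 2, hC, two_pos, fun x y μ hμ c ℓ hℓ hℓ1 => ?_⟩
  set D := 16 / (ρ * (1 - ρ)) * dmet c ℓ x y with hD
  have hD0 : 0 ≤ D := mul_nonneg (by linarith) (dmet_nonneg ..)
  set f : ℝ → ℝ≥0∞ := fun r => μ (coneA x (itv c (2 * ℓ)) (ρ * r) r) with hf
  have hfm : Measurable f := measurable_measure_coneA μ x _ hρ0 hρ1
  have hscale : ∀ a : ℝ, 1 / 2 ≤ a → a ≤ 2 →
      ∫⁻ r in Ioc D (1 / 2), f (a * r) / ENNReal.ofReal (r ^ 2) ≤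
        ENNReal.ofReal a * ∫⁻ r in Ioc (D / 2) 1, f r / ENNReal.ofReal (r ^ 2) := by
    intro a ha ha2
    rw [setLIntegral_comp_mul_div_sq hfm (by linarith) hD0]
    gcongr
    · nlinarith
    · linarith
  calc ∫⁻ r in Ioc D (1 / 2),
        μ (coneA y (itv c (1.5 * ℓ)) (ρ * r) r) / ENNReal.ofReal (r ^ 2)
      ≤ ∫⁻ r in Ioc D (1 / 2), (f ((1 + ρ) / 2 * r) / ENNReal.ofReal (r ^ 2) +
          f ((3 - ρ) / 2 * r) / ENNReal.ofReal (r ^ 2)) := by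
        refine setLIntegral_mono' measurableSet_Ioc fun r hr => ?_
        rw [← ENNReal.add_div]
        gcongr
        exact (measure_mono (coneA_subset_union hρ0 hρ1 hℓ hℓ1 hr.1)).trans (measure_union_le _ _)
    _ = (∫⁻ r in Ioc D (1 / 2), f ((1 + ρ) / 2 * r) / ENNReal.ofReal (r ^ 2)) +
          ∫⁻ r in Ioc D (1 / 2), f ((3 - ρ) / 2 * r) / ENNReal.ofReal (r ^ 2) :=
        lintegral_add_left (by fun_prop) _
    _ ≤ _ := add_le_add (hscale _ (by linarith) (by linarith)) (hscale _ (by linarith) (by linarith))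
    _ = _ := by
        rw [← add_mul, ← ENNReal.ofReal_add (by linarith) (by linarith)]
        congr 2
        ring

end
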